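/- With D_J the MDP constructed from a row-stochastic matrix J ∈ ℚ^{n×m} and r ≥ 1 as in the context: there exist nonnegative matrices A ∈ ℝ^{n×r} and W ∈ ℝ^{r×m} with J = A·W if and only if there exists a memoryless strategy α such that δ_s·M_α(w)·1 = δ_t·M_α(w)·1 for all words w ∈ L*, i.e., the Dirac distributions on s and on t are trace equivalent in D_J(α). -/

import Mathlib

open Matrix

/-- A labelled Markov decision process: a partial probabilistic transition function
`phi : S × A ⇀ (S → ℝ)` and a labelling function. -/
structure MDP (S A L : Type) where
  phi : S → A → Option (S → ℝ)
  label : S → L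

namespace MDP

variable {S A L : Type} [Fintype S] [Fintype A] [DecidableEq S]

/-- The MDP data is well-formed: every state has an available action, and every
defined `phi s m` is a probability distribution on `S`. -/
def IsValid (D : MDP S A L) : Prop :=
  (∀ s, ∃ m, (D.phi s m).isSome) ∧
    ∀ s m d, D.phi s m = some d → (∀ t, 0 ≤ d t) ∧ (∑ t, d t) = 1

/-- Transition probabilities, with `0` for unavailable actions. -/
def trans (D : MDP S A L) (s : S) (m : A) : S → ℝ :=
  (D.phi s m).getD 0

/-- A memoryless strategy: for each state a probability distribution on the
available actions. -/
def IsStrategy (D : MDP S A L) (α : S → A → ℝ) : Prop :=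
  ∀ s, (∀ m, 0 ≤ α s m) ∧ (∑ m, α s m) = 1 ∧ ∀ m, D.phi s m = none → α s m = 0

/-- Transition probabilities of the induced labelled Markov chain `D(α)`. -/
def tau (D : MDP S A L) (α : S → A → ℝ) (s t : S) : ℝ :=
  ∑ m, α s m * D.trans s m t

/-- The matrix `M_α(a)`. -/
def Mmat [DecidableEq L] (D : MDP S A L) (α : S → A → ℝ) (a : L) : Matrix S S ℝ :=
  Matrix.of fun s t => if D.label s = a then D.tau α s t else 0

/-- The matrix `M_α(w)` for a word `w ∈ L*` (identity for the empty word). -/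
def Mword [DecidableEq L] (D : MDP S A L) (α : S → A → ℝ) (w : List L) : Matrix S S ℝ :=
  (w.map (D.Mmat α)).prod

/-- A memoryless deterministic (MD) strategy, viewed as a function `S → A`
choosing an available action in each state. -/
def IsMD (D : MDP S A L) (β : S → A) : Prop := ∀ s, (D.phi s (β s)).isSome

/-- The memoryless strategy corresponding to an MD strategy. -/
def mdStrat [DecidableEq A] (β : S → A) : S → A → ℝ :=
  fun s m => if m = β s then 1 else 0

end MDP

/-- The Dirac distribution on a state. -/
def dirac {S : Type} [DecidableEq S] (x : S) : S → ℝ := fun y => if y = x then 1 else 0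

/-- States of the MDP `D_J`: `s, sᵢ, sᵢ', p_j` (left part) and `t, tᵢ, t_k', q_j`
(right part). -/
inductive NMFState (n m r : ℕ) where
  | s | si (i : Fin n) | si' (i : Fin n) | p (j : Fin m)
  | t | ti (i : Fin n) | ti' (k : Fin r) | q (j : Fin m)
deriving DecidableEq, Fintype

/-- Labels: `aᵢ` for `sᵢ, tᵢ`; `b_j` for `p_j, q_j`; `c` for the rest. -/
inductive NMFLabel (n m : ℕ) where
  | a (i : Fin n) | b (j : Fin m) | c
deriving DecidableEq, Fintype

/-- Actions: `m_{i,k}` (for the `tᵢ`), `m'_{k,j}` (for the `t_k'`), and a unique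
action for all other states. -/
abbrev NMFAct (r m : ℕ) : Type := Fin r ⊕ (Fin m ⊕ Unit)

/-- The transition function of the MDP `D_J`. -/
noncomputable def nmfPhi (n m r : ℕ) (J : Matrix (Fin n) (Fin m) ℚ) :
    NMFState n m r → NMFAct r m → Option (NMFState n m r → ℝ)
  | .s, .inr (.inr _) => some fun u => match u with | .si _ => 1 / (n : ℝ) | _ => 0
  | .si i, .inr (.inr _) => some (dirac (.si' i))
  | .si' i, .inr (.inr _) => some fun u => match u with | .p j => ((J i j : ℚ) : ℝ) | _ => 0
  | .p _, .inr (.inr _) => some (dirac .s)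
  | .t, .inr (.inr _) => some fun u => match u with | .ti _ => 1 / (n : ℝ) | _ => 0
  | .ti _, .inl k => some (dirac (.ti' k))
  | .ti' _, .inr (.inl j) => some (dirac (.q j))
  | .q _, .inr (.inr _) => some (dirac .t)
  | _, _ => none

/-- The labelling function of the MDP `D_J`. -/
def nmfLabel (n m r : ℕ) : NMFState n m r → NMFLabel n m
  | .si i => .a i
  | .ti i => .a i
  | .p j => .b j
  | .q j => .b j
  | _ => .c

/-- The MDP `D_J` constructed from the row-stochastic matrix `J` and `r`. -/
noncomputable def nmfMDP (n m r : ℕ) (J : Matrix (Fin n) (Fin m) ℚ) :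
    MDP (NMFState n m r) (NMFAct r m) (NMFLabel n m) :=
  ⟨nmfPhi n m r J, nmfLabel n m r⟩

theorem NMFState.sum_univ {n m r : ℕ} (f : NMFState n m r → ℝ) :
    ∑ x, f x = f .s + ∑ i, f (.si i) + ∑ i, f (.si' i) + ∑ j, f (.p j) +
      (f .t + ∑ i, f (.ti i) + ∑ k, f (.ti' k) + ∑ j, f (.q j)) := by
  let e : ((Unit ⊕ Fin n) ⊕ (Fin n ⊕ Fin m)) ⊕ ((Unit ⊕ Fin n) ⊕ (Fin r ⊕ Fin m)) ≃
      NMFState n m r :=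
    { toFun := fun
        | .inl (.inl (.inl _)) => .s
        | .inl (.inl (.inr i)) => .si i
        | .inl (.inr (.inl i)) => .si' i
        | .inl (.inr (.inr j)) => .p j
        | .inr (.inl (.inl _)) => .t
        | .inr (.inl (.inr i)) => .ti i
        | .inr (.inr (.inl k)) => .ti' k
        | .inr (.inr (.inr j)) => .q j
      invFun := fun
        | .s => .inl (.inl (.inl ()))
        | .si i => .inl (.inl (.inr i))
        | .si' i => .inl (.inr (.inl i))
        | .p j => .inl (.inr (.inr j))
        | .t => .inr (.inl (.inl ()))
        | .ti i => .inr (.inl (.inr i))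
        | .ti' k => .inr (.inr (.inl k))
        | .q j => .inr (.inr (.inr j))
      left_inv := by rintro (((_ | _) | (_ | _)) | ((_ | _) | (_ | _))) <;> rfl
      right_inv := by rintro (_ | _) <;> rfl }
  rw [← e.sum_comp]
  simp [Fintype.sum_sum_type, e]
  ring

theorem dirac_dotProduct {S : Type} [DecidableEq S] [Fintype S] (x : S) (v : S → ℝ) :
    dirac x ⬝ᵥ v = v x := by
  simp [dirac, dotProduct]

namespace MDP

variable {S A L : Type} [Fintype S] [Fintype A]

theorem sum_tau_mul {D : MDP S A L} {α : S → A → ℝ} (x : S) (v : S → ℝ) :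
    ∑ y, D.tau α x y * v y = ∑ k, α x k * ∑ y, D.trans x k y * v y := by
  simp only [tau, Finset.sum_mul, Finset.mul_sum, mul_assoc]
  exact Finset.sum_comm

/-- At a state with a single available action, the induced chain follows that action. -/
theorem IsStrategy.sum_tau_mul_of_unique {D : MDP S A L} {α : S → A → ℝ} (h : D.IsStrategy α)
    {x : S} {k₀ : A} (hk : ∀ k, k ≠ k₀ → D.phi x k = none) (v : S → ℝ) :
    ∑ y, D.tau α x y * v y = ∑ y, D.trans x k₀ y * v y := by
  obtain ⟨-, hsum, hzero⟩ := h x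
  have h0 : ∀ k, k ≠ k₀ → α x k = 0 := fun k hne => hzero k (hk k hne)
  rw [Fintype.sum_eq_single k₀ h0] at hsum
  rw [sum_tau_mul, Fintype.sum_eq_single k₀ fun k hne => by rw [h0 k hne, zero_mul],
    hsum, one_mul]

variable [DecidableEq S] [DecidableEq L]

/-- The probability that the run of `D(α)` from a given state emits the word `w`. -/
def wordProb (D : MDP S A L) (α : S → A → ℝ) (w : List L) : S → ℝ :=
  (D.Mword α w).mulVec 1

theorem wordProb_nil (D : MDP S A L) (α : S → A → ℝ) (x : S) : D.wordProb α [] x = 1 := by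
  simp [wordProb, Mword]

theorem wordProb_cons (D : MDP S A L) (α : S → A → ℝ) (l : L) (w : List L) (x : S) :
    D.wordProb α (l :: w) x =
      if D.label x = l then ∑ y, D.tau α x y * D.wordProb α w y else 0 := by
  have h : D.wordProb α (l :: w) = (D.Mmat α l).mulVec (D.wordProb α w) := by
    simp [wordProb, Mword, Matrix.mulVec_mulVec]
  rw [h]
  by_cases hx : D.label x = l <;> simp [Matrix.mulVec, dotProduct, Mmat, hx]

end MDP

section StrategyStep

open MDP

variable {n m r : ℕ} {J : Matrix (Fin n) (Fin m) ℚ} {α : NMFState n m r → NMFAct r m → ℝ}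

theorem nmf_sum_tau_s (h : (nmfMDP n m r J).IsStrategy α) (v : NMFState n m r → ℝ) :
    ∑ y, (nmfMDP n m r J).tau α .s y * v y = ∑ i, 1 / (n : ℝ) * v (.si i) := by
  rw [h.sum_tau_mul_of_unique (k₀ := .inr (.inr ()))
    (by rintro (_ | _ | _) hk <;> first | rfl | exact absurd rfl hk)]
  simp [NMFState.sum_univ, MDP.trans, nmfMDP, nmfPhi]

theorem nmf_sum_tau_si (h : (nmfMDP n m r J).IsStrategy α) (v : NMFState n m r → ℝ) (i : Fin n) :
    ∑ y, (nmfMDP n m r J).tau α (.si i) y * v y = v (.si' i) := by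
  rw [h.sum_tau_mul_of_unique (k₀ := .inr (.inr ()))
    (by rintro (_ | _ | _) hk <;> first | rfl | exact absurd rfl hk)]
  simp [MDP.trans, nmfMDP, nmfPhi, dirac]

theorem nmf_sum_tau_si' (h : (nmfMDP n m r J).IsStrategy α) (v : NMFState n m r → ℝ)
    (i : Fin n) :
    ∑ y, (nmfMDP n m r J).tau α (.si' i) y * v y = ∑ j, (J i j : ℝ) * v (.p j) := by
  rw [h.sum_tau_mul_of_unique (k₀ := .inr (.inr ()))
    (by rintro (_ | _ | _) hk <;> first | rfl | exact absurd rfl hk)]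
  simp [NMFState.sum_univ, MDP.trans, nmfMDP, nmfPhi]

theorem nmf_sum_tau_p (h : (nmfMDP n m r J).IsStrategy α) (v : NMFState n m r → ℝ) (j : Fin m) :
    ∑ y, (nmfMDP n m r J).tau α (.p j) y * v y = v .s := by
  rw [h.sum_tau_mul_of_unique (k₀ := .inr (.inr ()))
    (by rintro (_ | _ | _) hk <;> first | rfl | exact absurd rfl hk)]
  simp [MDP.trans, nmfMDP, nmfPhi, dirac]

theorem nmf_sum_tau_t (h : (nmfMDP n m r J).IsStrategy α) (v : NMFState n m r → ℝ) :
    ∑ y, (nmfMDP n m r J).tau α .t y * v y = ∑ i, 1 / (n : ℝ) * v (.ti i) := by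
  rw [h.sum_tau_mul_of_unique (k₀ := .inr (.inr ()))
    (by rintro (_ | _ | _) hk <;> first | rfl | exact absurd rfl hk)]
  simp [NMFState.sum_univ, MDP.trans, nmfMDP, nmfPhi]

theorem nmf_sum_tau_ti (v : NMFState n m r → ℝ) (i : Fin n) :
    ∑ y, (nmfMDP n m r J).tau α (.ti i) y * v y = ∑ k, α (.ti i) (.inl k) * v (.ti' k) := by
  rw [sum_tau_mul]
  simp [Fintype.sum_sum_type, MDP.trans, nmfMDP, nmfPhi, dirac]

theorem nmf_sum_tau_ti' (v : NMFState n m r → ℝ) (k : Fin r) :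
    ∑ y, (nmfMDP n m r J).tau α (.ti' k) y * v y =
      ∑ j, α (.ti' k) (.inr (.inl j)) * v (.q j) := by
  rw [sum_tau_mul]
  simp [Fintype.sum_sum_type, MDP.trans, nmfMDP, nmfPhi, dirac]

theorem nmf_sum_tau_q (h : (nmfMDP n m r J).IsStrategy α) (v : NMFState n m r → ℝ) (j : Fin m) :
    ∑ y, (nmfMDP n m r J).tau α (.q j) y * v y = v .t := by
  rw [h.sum_tau_mul_of_unique (k₀ := .inr (.inr ()))
    (by rintro (_ | _ | _) hk <;> first | rfl | exact absurd rfl hk)]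
  simp [MDP.trans, nmfMDP, nmfPhi, dirac]

/-- The left part simulates the right part when `J` factors through the strategy. -/
theorem nmf_wordProb_eq (h : (nmfMDP n m r J).IsStrategy α)
    (hJ : ∀ i j, (J i j : ℝ) = ∑ k, α (.ti i) (.inl k) * α (.ti' k) (.inr (.inl j)))
    (w : List (NMFLabel n m)) :
    (nmfMDP n m r J).wordProb α w .s = (nmfMDP n m r J).wordProb α w .t ∧
    (∀ j, (nmfMDP n m r J).wordProb α w (.p j) = (nmfMDP n m r J).wordProb α w (.q j)) ∧
    (∀ i, (nmfMDP n m r J).wordProb α w (.si i) = (nmfMDP n m r J).wordProb α w (.ti i)) ∧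
    ∀ i, (nmfMDP n m r J).wordProb α w (.si' i) =
      ∑ k, α (.ti i) (.inl k) * (nmfMDP n m r J).wordProb α w (.ti' k) := by
  induction w with
  | nil =>
    refine ⟨by simp only [wordProb_nil], fun j => by simp only [wordProb_nil],
      fun i => by simp only [wordProb_nil], fun i => ?_⟩
    obtain ⟨-, hsum, hzero⟩ := h (.ti i)
    have h0 : ∀ x, α (.ti i) (.inr x) = 0 := fun x => hzero _ rfl
    simp only [Fintype.sum_sum_type] at hsum
    simpa [wordProb_nil, h0] using hsum.symm
  | cons l w ih =>
    obtain ⟨hs, hp, hsi, hsi'⟩ := ih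
    simp only [wordProb_cons, nmf_sum_tau_s h, nmf_sum_tau_si h, nmf_sum_tau_si' h,
      nmf_sum_tau_p h, nmf_sum_tau_t h, nmf_sum_tau_ti, nmf_sum_tau_ti', nmf_sum_tau_q h]
    refine ⟨by simp only [hsi]; rfl, fun j => by simp only [hs]; rfl,
      fun i => by simp only [hsi']; rfl, fun i => ?_⟩
    have hl (k : Fin r) :
        (nmfMDP n m r J).label (.ti' k) = (nmfMDP n m r J).label (.si' i) := rfl
    simp only [hl]
    split_ifs
    · simp only [hJ, hp, Finset.sum_mul, Finset.mul_sum, mul_assoc]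
      exact Finset.sum_comm
    · simp

/-- The word `c aᵢ c b_j` determines the `(i, j)` entry of `J`. -/
theorem nmf_entry_of_wordProb_eq (hn : 1 ≤ n) (h : (nmfMDP n m r J).IsStrategy α)
    (i : Fin n) (j : Fin m)
    (hw : (nmfMDP n m r J).wordProb α [.c, .a i, .c, .b j] .s =
      (nmfMDP n m r J).wordProb α [.c, .a i, .c, .b j] .t) :
    (J i j : ℝ) = ∑ k, α (.ti i) (.inl k) * α (.ti' k) (.inr (.inl j)) := by
  have hn0 : (n : ℝ) ≠ 0 := by positivity
  simp only [wordProb_cons, wordProb_nil, nmf_sum_tau_s h, nmf_sum_tau_si h, nmf_sum_tau_si' h,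
    nmf_sum_tau_p h, nmf_sum_tau_t h, nmf_sum_tau_ti, nmf_sum_tau_ti', nmf_sum_tau_q h] at hw
  simpa [nmfMDP, nmfLabel, hn0] using hw

end StrategyStep

/-- A nonnegative factorization of a row-stochastic matrix can be normalized to a factorization
into row-stochastic matrices. -/
theorem exists_stochastic_factorization {n m r : ℕ} (hm : 1 ≤ m)
    {A : Matrix (Fin n) (Fin r) ℝ} {W : Matrix (Fin r) (Fin m) ℝ}
    (hA : ∀ i k, 0 ≤ A i k) (hW : ∀ k j, 0 ≤ W k j) (h : ∀ i, ∑ j, (A * W) i j = 1) :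
    ∃ (A' : Matrix (Fin n) (Fin r) ℝ) (W' : Matrix (Fin r) (Fin m) ℝ),
      (∀ i k, 0 ≤ A' i k) ∧ (∀ k j, 0 ≤ W' k j) ∧ (∀ i, ∑ k, A' i k = 1) ∧
      (∀ k, ∑ j, W' k j = 1) ∧ A * W = A' * W' := by
  have hσ (k : Fin r) : 0 ≤ ∑ j, W k j := Finset.sum_nonneg fun j _ => hW k j
  have hm0 : (m : ℝ) ≠ 0 := by positivity
  refine ⟨fun i k => A i k * ∑ j, W k j,
    fun k j => if ∑ j, W k j = 0 then 1 / (m : ℝ) else W k j / ∑ j, W k j,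
    fun i k => mul_nonneg (hA i k) (hσ k), fun k j => ?_, fun i => ?_, fun k => ?_, ?_⟩
  · dsimp only
    split_ifs
    · positivity
    · exact div_nonneg (hW k j) (hσ k)
  · rw [← h i]
    simp only [Matrix.mul_apply, Finset.mul_sum]
    exact Finset.sum_comm
  · dsimp only
    split_ifs with h0
    · simp [hm0]
    · rw [← Finset.sum_div, div_self h0]
  · ext i j
    simp only [Matrix.mul_apply]
    refine Finset.sum_congr rfl fun k _ => ?_
    dsimp only
    split_ifs with h0
    · have hz : W k j = 0 :=
        (Finset.sum_eq_zero_iff_of_nonneg fun j _ => hW k j).1 h0 j (Finset.mem_univ j)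
      rw [hz, h0]
      simp
    · field_simp

/-- The strategy playing according to the rows of `A` in the states `ti` and according to the
rows of `W` in their successors. -/
def nmfStrategy {n m r : ℕ} (A : Matrix (Fin n) (Fin r) ℝ) (W : Matrix (Fin r) (Fin m) ℝ) :
    NMFState n m r → NMFAct r m → ℝ
  | .ti i, .inl k => A i k
  | .ti _, _ => 0
  | .ti' k, .inr (.inl j) => W k j
  | .ti' _, _ => 0
  | _, .inr (.inr _) => 1
  | _, _ => 0

theorem nmfStrategy_isStrategy {n m r : ℕ} (J : Matrix (Fin n) (Fin m) ℚ)
    {A : Matrix (Fin n) (Fin r) ℝ} {W : Matrix (Fin r) (Fin m) ℝ}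
    (hA : ∀ i k, 0 ≤ A i k) (hW : ∀ k j, 0 ≤ W k j) (hA1 : ∀ i, ∑ k, A i k = 1)
    (hW1 : ∀ k, ∑ j, W k j = 1) : (nmfMDP n m r J).IsStrategy (nmfStrategy A W) := by
  intro x
  refine ⟨fun k => ?_, ?_, fun k => ?_⟩
  · rcases x with _ | _ <;> rcases k with _ | _ | _ <;> simp [nmfStrategy, hA, hW]
  · rcases x with _ | _ <;> simp [nmfStrategy, Fintype.sum_sum_type, hA1, hW1]
  · rcases x with _ | _ <;> rcases k with _ | _ | _ <;> simp [nmfStrategy, nmfMDP, nmfPhi]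

/-- `J` admits a nonnegative factorization `J = A·W` of inner
dimension `r` iff there is a memoryless strategy `α` such that the Dirac
distributions on `s` and on `t` are trace equivalent in `D_J(α)`. -/
theorem nmf_iff_trace_equivalent
    (n m r : ℕ) (hn : 1 ≤ n) (hm : 1 ≤ m) (hr : 1 ≤ r)
    (J : Matrix (Fin n) (Fin m) ℚ)
    (hJnonneg : ∀ i j, 0 ≤ J i j) (hJstoch : ∀ i, (∑ j, J i j) = 1) :
    (∃ (A : Matrix (Fin n) (Fin r) ℝ) (W : Matrix (Fin r) (Fin m) ℝ),
        (∀ i k, 0 ≤ A i k) ∧ (∀ k j, 0 ≤ W k j) ∧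
        J.map (fun x => (x : ℝ)) = A * W) ↔
      ∃ α, (nmfMDP n m r J).IsStrategy α ∧
        ∀ w : List (NMFLabel n m),
          dirac (NMFState.s : NMFState n m r) ⬝ᵥ ((nmfMDP n m r J).Mword α w).mulVec 1 =
            dirac (NMFState.t : NMFState n m r) ⬝ᵥ ((nmfMDP n m r J).Mword α w).mulVec 1 := by
  constructor
  · rintro ⟨A, W, hA, hW, hAW⟩
    have hrow (i : Fin n) : ∑ j, (A * W) i j = 1 := by
      rw [← hAW]
      simp only [Matrix.map_apply]
      exact_mod_cast hJstoch i
    obtain ⟨A', W', hA', hW', hA1, hW1, hAW'⟩ := exists_stochastic_factorization hm hA hW hrow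
    have hstrat := nmfStrategy_isStrategy J hA' hW' hA1 hW1
    refine ⟨nmfStrategy A' W', hstrat, fun w => ?_⟩
    rw [dirac_dotProduct, dirac_dotProduct]
    refine (nmf_wordProb_eq hstrat (fun i j => ?_) w).1
    have hij := congrFun (congrFun (hAW.trans hAW') i) j
    simpa [Matrix.mul_apply, nmfStrategy] using hij
  · rintro ⟨α, hα, hw⟩
    refine ⟨fun i k => α (.ti i) (.inl k), fun k j => α (.ti' k) (.inr (.inl j)),
      fun i k => (hα _).1 _, fun k j => (hα _).1 _, ?_⟩
    ext i j
    have hij := hw [.c, .a i, .c, .b j]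
    rw [dirac_dotProduct, dirac_dotProduct] at hij
    exact nmf_entry_of_wordProb_eq hn hα i j hij
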